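/- Let T ∈ B(H) be a contraction and let φ be a state on B(H) whose restriction to C*(1,T) is faithful, i.e. for a ∈ C*(1,T), φ(a* a) = 0 implies a = 0. Let U ∈ B(K) be a minimal unitary dilation of T: K is a complex Hilbert space, j : H → K is a linear isometry, U is unitary, j* ∘ U^k ∘ j = T^k for all k ∈ ℕ, and K equals the closed linear span of {U^k (j h) : k ∈ ℤ, h ∈ H}. Then the compressed state ψ defined by ψ(a) = φ(j* ∘ a ∘ j) is faithful on C*(U): for every a ∈ C*(U) (the unital C*-subalgebra of B(K) generated by U), ψ(a* a) = 0 implies a = 0. -/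

import Mathlib

noncomputable section

variable {E F : Type*} [NormedAddCommGroup E] [InnerProductSpace ℂ E] [CompleteSpace E]
  [NormedAddCommGroup F] [InnerProductSpace ℂ F] [CompleteSpace F]

/-- `T(k)`: integer power, `T^k` for `k ≥ 0` and `(T*)^{-k}` for `k < 0`.
For a unitary `U` this is the integer power of `U`. -/
def opZpow (T : E →L[ℂ] E) (k : ℤ) : E →L[ℂ] E :=
  if 0 ≤ k then T ^ k.toNat else (ContinuousLinearMap.adjoint T) ^ (-k).toNat

/-- The unital C*-subalgebra of `B(E)` generated by a set of operators. -/
def CstarGen (s : Set (E →L[ℂ] E)) : StarSubalgebra ℂ (E →L[ℂ] E) :=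
  (StarAlgebra.adjoin ℂ s).topologicalClosure

/-- Compression by a linear isometry, as a linear map `B(F) → B(E)`. -/
def compressL (j : E →ₗᵢ[ℂ] F) : (F →L[ℂ] F) →ₗ[ℂ] (E →L[ℂ] E) where
  toFun a := (ContinuousLinearMap.adjoint j.toContinuousLinearMap).comp
      (a.comp j.toContinuousLinearMap)
  map_add' a b := by
    simp [ContinuousLinearMap.add_comp, ContinuousLinearMap.comp_add]
  map_smul' c a := by
    simp [ContinuousLinearMap.smul_comp, ContinuousLinearMap.comp_smulₛₗ]

/-- `φ` is a state on `B(E)`. -/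
def IsState (φ : (E →L[ℂ] E) →ₗ[ℂ] ℂ) : Prop :=
  φ 1 = 1 ∧ ∀ a : E →L[ℂ] E, ∃ r : ℝ, 0 ≤ r ∧ φ (star a * a) = (r : ℂ)

/-- Every element of the star algebra generated by a unitary lies in the span of its integer
powers. -/
theorem mem_span_zpow_of_mem_adjoin_unitary (u : unitary (F →L[ℂ] F)) {x : F →L[ℂ] F}
    (hx : x ∈ StarAlgebra.adjoin ℂ {(u : F →L[ℂ] F)}) :
    x ∈ Submodule.span ℂ (Set.range fun k : ℤ => ((u ^ k : unitary (F →L[ℂ] F)) : F →L[ℂ] F)) := by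
  rw [← StarSubalgebra.mem_toSubalgebra, StarAlgebra.adjoin_toSubalgebra,
    ← Subalgebra.mem_toSubmodule, Algebra.adjoin_eq_span] at hx
  refine Submodule.span_mono (fun y hy => ?_) hx
  induction hy using Submonoid.closure_induction with
  | mem y hy =>
    simp only [Set.star_singleton, Set.singleton_union, Set.mem_insert_iff,
      Set.mem_singleton_iff] at hy
    rcases hy with rfl | rfl
    · exact ⟨1, by simp⟩
    · exact ⟨-1, by simp [← Unitary.star_eq_inv]⟩
  | one => exact ⟨0, by simp⟩
  | mul y z _ _ hy hz =>
    obtain ⟨m, rfl⟩ := hy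
    obtain ⟨n, rfl⟩ := hz
    exact ⟨m + n, by simp [zpow_add]⟩

theorem compressL_star (j : E →ₗᵢ[ℂ] F) (a : F →L[ℂ] F) :
    compressL j (star a) = star (compressL j a) := by
  simp only [compressL, LinearMap.coe_mk, AddHom.coe_mk, ContinuousLinearMap.star_eq_adjoint,
    ContinuousLinearMap.adjoint_comp, ContinuousLinearMap.adjoint_adjoint,
    ContinuousLinearMap.comp_assoc]

theorem continuous_compressL (j : E →ₗᵢ[ℂ] F) : Continuous (compressL j) := by
  change Continuous fun a : F →L[ℂ] F =>
    (ContinuousLinearMap.adjoint j.toContinuousLinearMap).comp (a.comp j.toContinuousLinearMap)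
  fun_prop

/-- Compression maps the C*-algebra of a unitary dilation of `T` into that of `T`. -/
theorem compressL_mem_CstarGen_of_dilation (T : E →L[ℂ] E) (j : E →ₗᵢ[ℂ] F)
    (u : unitary (F →L[ℂ] F))
    (hdil : ∀ k : ℕ, compressL j ((u : F →L[ℂ] F) ^ k) = T ^ k)
    {a : F →L[ℂ] F} (ha : a ∈ CstarGen {(u : F →L[ℂ] F)}) :
    compressL j a ∈ CstarGen {T} := by
  have hT (k : ℕ) : T ^ k ∈ CstarGen {T} :=
    pow_mem (StarSubalgebra.le_topologicalClosure _ (StarAlgebra.self_mem_adjoin_singleton ℂ T)) k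
  have hpow : Submodule.span ℂ
      (Set.range fun k : ℤ => ((u ^ k : unitary (F →L[ℂ] F)) : F →L[ℂ] F)) ≤
      (CstarGen {T}).toSubalgebra.toSubmodule.comap (compressL j) := by
    rw [Submodule.span_le]
    rintro _ ⟨k, rfl⟩
    change compressL j _ ∈ CstarGen {T}
    cases k with
    | ofNat n => simpa [hdil] using hT n
    | negSucc n =>
      have h : ((u ^ Int.negSucc n : unitary (F →L[ℂ] F)) : F →L[ℂ] F) =
          star ((u : F →L[ℂ] F) ^ (n + 1)) := by
        rw [zpow_negSucc, ← Unitary.star_eq_inv, Unitary.coe_star, SubmonoidClass.coe_pow]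
      simp only [h, compressL_star, hdil]
      exact star_mem (hT (n + 1))
  have hclosed : IsClosed {x : F →L[ℂ] F | compressL j x ∈ CstarGen {T}} :=
    (StarSubalgebra.isClosed_topologicalClosure _).preimage (continuous_compressL j)
  exact closure_minimal (fun x hx => hpow (mem_span_zpow_of_mem_adjoin_unitary u hx)) hclosed ha

/-- Elements of the C*-algebra generated by a unitary commute with that unitary. -/
theorem commute_of_mem_CstarGen_unitary (u : unitary (F →L[ℂ] F)) {a : F →L[ℂ] F}
    (ha : a ∈ CstarGen {(u : F →L[ℂ] F)}) : Commute a (u : F →L[ℂ] F) := by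
  have hu : (u : F →L[ℂ] F) ∈ StarSubalgebra.centralizer ℂ {(u : F →L[ℂ] F)} := by
    simp [StarSubalgebra.mem_centralizer_iff]
  exact ((StarSubalgebra.mem_centralizer_iff ℂ).mp
    (StarSubalgebra.topologicalClosure_adjoin_le_centralizer_centralizer ℂ _ ha) _ hu).1.symm

/-- A state is nonnegative on positive operators. -/
theorem IsState.exists_nonneg_eq {φ : (E →L[ℂ] E) →ₗ[ℂ] ℂ} (hφ : IsState φ) {c : E →L[ℂ] E}
    (hc : 0 ≤ c) : ∃ r : ℝ, 0 ≤ r ∧ φ c = r := by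
  obtain ⟨s, rfl⟩ := CStarAlgebra.nonneg_iff_eq_star_mul_self.mp hc
  exact hφ.2 s

/-- If a state vanishes on a positive operator `c`, it vanishes on `c⋆ c`. -/
theorem IsState.star_mul_self_eq_zero {φ : (E →L[ℂ] E) →ₗ[ℂ] ℂ} (hφ : IsState φ)
    {c : E →L[ℂ] E} (hc : 0 ≤ c) (h : φ c = 0) : φ (star c * c) = 0 := by
  obtain ⟨s, rfl⟩ := CStarAlgebra.nonneg_iff_eq_star_mul_self.mp hc
  have key : star (star s * s) * (star s * s) ≤ ‖s * star s‖ • (star s * s) := by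
    simpa [mul_assoc] using
      CStarAlgebra.star_left_conjugate_le_norm_smul (a := s) (b := s * star s)
  obtain ⟨p, hp, hpe⟩ := hφ.exists_nonneg_eq (sub_nonneg.mpr key)
  obtain ⟨q, hq, hqe⟩ := hφ.2 (star s * s)
  rw [map_sub, hqe, ← Complex.coe_smul, map_smul, h, smul_zero, zero_sub] at hpe
  have : -q = p := by exact_mod_cast hpe
  rw [hqe, show q = 0 by linarith, Complex.ofReal_zero]

theorem comp_eq_zero_of_compressL_star_mul_self_eq_zero (j : E →ₗᵢ[ℂ] F) {a : F →L[ℂ] F}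
    (h : compressL j (star a * a) = 0) (x : E) : a (j x) = 0 := by
  have h' : ContinuousLinearMap.adjoint (a.comp j.toContinuousLinearMap) ∘L
      (a.comp j.toContinuousLinearMap) = 0 := by
    rw [← h, ContinuousLinearMap.adjoint_comp]
    rfl
  have := ContinuousLinearMap.apply_norm_sq_eq_inner_adjoint_left
    (a.comp j.toContinuousLinearMap) x
  rw [h'] at this
  simpa using this

/-- If `φ` is faithful on `C*(1,T)` and `U` is the minimal unitary dilation of the
contraction `T`, then the compressed state is faithful on `C*(U)`. -/
theorem compressed_state_faithful_of_minimal_dilation {H K : Type*}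
    [NormedAddCommGroup H] [InnerProductSpace ℂ H] [CompleteSpace H]
    [NormedAddCommGroup K] [InnerProductSpace ℂ K] [CompleteSpace K]
    (T : H →L[ℂ] H) (hcontr : ‖T‖ ≤ 1)
    (φ : (H →L[ℂ] H) →ₗ[ℂ] ℂ) (hφ : IsState φ)
    (hfaithful : ∀ a ∈ CstarGen {T}, φ (star a * a) = 0 → a = 0)
    (j : H →ₗᵢ[ℂ] K) (U : K →L[ℂ] K)
    (hU : U ∈ unitary (K →L[ℂ] K))
    (hdil : ∀ k : ℕ,
      (ContinuousLinearMap.adjoint j.toContinuousLinearMap).comp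
        ((U ^ k).comp j.toContinuousLinearMap) = T ^ k)
    (hmin : (Submodule.span ℂ {x : K | ∃ (k : ℤ) (h : H), x = opZpow U k (j h)}).topologicalClosure
      = ⊤) :
    ∀ a ∈ CstarGen {U}, φ (compressL j (star a * a)) = 0 → a = 0 := by
  intro a ha h
  lift U to unitary (K →L[ℂ] K) using hU
  have hmem : compressL j (star a * a) ∈ CstarGen {T} :=
    compressL_mem_CstarGen_of_dilation T j U hdil (mul_mem (star_mem ha) ha)
  have hpos : 0 ≤ compressL j (star a * a) := by
    have := star_mul_self_nonneg a
    rw [ContinuousLinearMap.nonneg_iff_isPositive] at this ⊢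
    exact this.adjoint_conj j.toContinuousLinearMap
  have haj := comp_eq_zero_of_compressL_star_mul_self_eq_zero j
    (hfaithful _ hmem (hφ.star_mul_self_eq_zero hpos h))
  have hcomm := commute_of_mem_CstarGen_unitary U ha
  have hcomm' : Commute a (ContinuousLinearMap.adjoint (U : K →L[ℂ] K)) := by
    simpa [ContinuousLinearMap.star_eq_adjoint] using
      (commute_of_mem_CstarGen_unitary U (star_mem ha)).star_star
  refine ContinuousLinearMap.ext_on (Submodule.dense_iff_topologicalClosure_eq_top.mpr hmin) ?_
  rintro _ ⟨k, x, rfl⟩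
  have hk : Commute a (opZpow (U : K →L[ℂ] K) k) := by
    unfold opZpow
    split_ifs
    · exact hcomm.pow_right _
    · exact hcomm'.pow_right _
  have := congrArg (fun S : K →L[ℂ] K => S (j x)) hk.eq
  simpa [haj] using this

end
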